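/- arXiv:2102.06898 — 2 statements merged into one kernel-verified Lean document; each statement's English description precedes it below -/
import Mathlib

section
/- Let V be a real vector space, M ⊆ V a nonempty convex set, and ≽ a preorder on M satisfying SI and MC. If the dimension (Module.rank over ℝ) of the linear span of {x − y : x, y ∈ M} is at most ℵ₀, then ≽ satisfies MR: there exists a nonempty set of mixture-preserving functions M → ℝ that represents ≽. -/
open Cardinal

variable {V : Type*} [AddCommGroup V] [Module ℝ V]

/-- `u : V → ℝ` is mixture preserving on the convex set `M`. -/
def MixPres (M : Set V) (u : V → ℝ) : Prop :=
  ∀ x ∈ M, ∀ y ∈ M, ∀ α : ℝ, 0 ≤ α → α ≤ 1 →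
    u (α • x + (1 - α) • y) = α * u x + (1 - α) * u y

/-- Axiom MR: existence of a mixture-preserving multi-representation of `r` on `M`. -/
def AxMR (M : Set V) (r : V → V → Prop) : Prop :=
  ∃ U : Set (V → ℝ), U.Nonempty ∧ (∀ u ∈ U, MixPres M u) ∧
    ∀ x ∈ M, ∀ y ∈ M, (r x y ↔ ∀ u ∈ U, u x ≥ u y)

/-- Axiom MC (mixture continuity). -/
def AxMC (M : Set V) (r : V → V → Prop) : Prop :=
  ∀ x ∈ M, ∀ y ∈ M, ∀ z ∈ M,
    (∀ α : ℝ, 0 < α → α ≤ 1 →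
      r (α • x + (1 - α) • y) z ∧ ¬ r z (α • x + (1 - α) • y)) →
    r y z

/-- Axiom SI (strong independence). -/
def AxSI (M : Set V) (r : V → V → Prop) : Prop :=
  ∀ x ∈ M, ∀ y ∈ M, ∀ z ∈ M, ∀ α : ℝ, 0 < α → α < 1 →
    (r x y ↔ r (α • x + (1 - α) • z) (α • y + (1 - α) • z))

/-- Axiom CD (countable domination). -/
def AxCD (M : Set V) (r : V → V → Prop) : Prop :=
  ∃ D : Set (V × V), D.Countable ∧
    (∀ p ∈ D, p.1 ∈ M ∧ p.2 ∈ M ∧ r p.1 p.2) ∧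
    ∀ s ∈ M, ∀ t ∈ M, r s t →
      ∃ p ∈ D, ∃ α : ℝ, 0 < α ∧ α < 1 ∧
        r (α • p.1 + (1 - α) • t) (α • p.2 + (1 - α) • s)

/-- Axiom SD (singleton domination). -/
def AxSD (M : Set V) (r : V → V → Prop) : Prop :=
  ∃ x ∈ M, ∃ y ∈ M, r x y ∧
    ∀ s ∈ M, ∀ t ∈ M, r s t →
      ∃ α : ℝ, 0 < α ∧ α < 1 ∧
        r (α • x + (1 - α) • t) (α • y + (1 - α) • s)

/-- The positive cone of the preorder `r` on `M`. -/
def posCone (M : Set V) (r : V → V → Prop) : Set V :=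
  {v | ∃ l : ℝ, 0 < l ∧ ∃ x ∈ M, ∃ y ∈ M, r x y ∧ v = l • (x - y)}

/-- A set is algebraically closed. -/
def AlgClosed (S : Set V) : Prop :=
  ∀ v w : V, (∀ α : ℝ, 0 < α → α ≤ 1 → (1 - α) • v + α • w ∈ S) → v ∈ S

/-- The weak topology on a real vector space: the coarsest topology making all
linear functionals continuous. -/
def weakTop (W : Type*) [AddCommGroup W] [Module ℝ W] : TopologicalSpace W :=
  ⨅ f : W →ₗ[ℝ] ℝ, TopologicalSpace.induced (⇑f) inferInstance

/-- The linear span of the set of differences of elements of `M`. -/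
def diffSpan (M : Set V) : Submodule ℝ V :=
  Submodule.span ℝ {v | ∃ x ∈ M, ∃ y ∈ M, v = x - y}

/-- `u` is strictly increasing for `r` on `M`. -/
def StrIncr (M : Set V) (r : V → V → Prop) (u : V → ℝ) : Prop :=
  (∀ x ∈ M, ∀ y ∈ M, r x y → u x ≥ u y) ∧
  (∀ x ∈ M, ∀ y ∈ M, r x y → ¬ r y x → u x > u y)

/-- An algebraically closed convex cone in a finite-dimensional space is topologically closed,
provided that it spans the space. -/
lemma AlgClosed.isClosed_of_span_eq_top {E : Type*} [NormedAddCommGroup E] [NormedSpace ℝ E]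
    [FiniteDimensional ℝ E] {C : PointedCone ℝ E} (hC : AlgClosed (C : Set E))
    (hspan : Submodule.span ℝ (C : Set E) = ⊤) : IsClosed (C : Set E) := by
  have hconv : Convex ℝ (C : Set E) := C.convex
  have hne : (interior (C : Set E)).Nonempty := by
    rw [hconv.interior_nonempty_iff_affineSpan_eq_top,
      AffineSubspace.affineSpan_eq_top_iff_vectorSpan_eq_top_of_nonempty ℝ E E ⟨0, C.zero_mem⟩,
      vectorSpan_eq_span_vsub_set_right ℝ (show (0 : E) ∈ (C : Set E) from C.zero_mem)]
    simpa using hspan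
  obtain ⟨p, hp⟩ := hne
  refine isClosed_of_closure_subset fun x hx => hC x p fun α h0 h1 => interior_subset ?_
  exact hconv.combo_closure_interior_mem_interior hx hp (by linarith) h0 (by ring)

/-- The preimage of an algebraically closed set under a linear map is algebraically closed. -/
lemma AlgClosed.preimage {E F : Type*} [AddCommGroup E] [Module ℝ E] [AddCommGroup F]
    [Module ℝ F] {S : Set E} (hS : AlgClosed S) (L : F →ₗ[ℝ] E) : AlgClosed (L ⁻¹' S) := by
  intro v w h
  refine hS (L v) (L w) fun α h0 h1 => ?_
  simpa using h α h0 h1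

/-- An algebraically closed convex cone in a finite-dimensional space is topologically closed. -/
lemma AlgClosed.isClosed {E : Type*} [NormedAddCommGroup E] [NormedSpace ℝ E]
    [FiniteDimensional ℝ E] {C : PointedCone ℝ E} (hC : AlgClosed (C : Set E)) :
    IsClosed (C : Set E) := by
  set S := Submodule.span ℝ (C : Set E) with hS
  have hsub : (C : Set E) ⊆ S := Submodule.subset_span
  have h : IsClosed ((C.comap S.subtype : PointedCone ℝ S) : Set S) := by
    refine AlgClosed.isClosed_of_span_eq_top (hC.preimage S.subtype) ?_
    exact Submodule.span_span_coe_preimage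
  have himg : S.subtype '' ((C.comap S.subtype : PointedCone ℝ S) : Set S) = C := by
    ext x
    constructor
    · rintro ⟨y, hy, rfl⟩
      exact hy
    · intro hx
      exact ⟨⟨x, hsub hx⟩, hx, rfl⟩
  rw [← himg]
  exact (Submodule.closed_of_finiteDimensional S).isClosedEmbedding_subtypeVal.isClosedMap _ h

section Cones

variable {E : Type*} [AddCommGroup E] [Module ℝ E]

/-- The preimage of an algebraically closed convex cone under a linear map defined on a
finite-dimensional space is topologically closed. -/
lemma AlgClosed.isClosed_preimage {F : Type*} [NormedAddCommGroup F] [NormedSpace ℝ F]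
    [FiniteDimensional ℝ F] {C : PointedCone ℝ E} (hC : AlgClosed (C : Set E)) (L : F →ₗ[ℝ] E) :
    IsClosed (L ⁻¹' (C : Set E)) :=
  AlgClosed.isClosed (C := C.comap L) (hC.preimage L)

lemma PointedCone.mem_of_pos_smul_mem {C : PointedCone ℝ E} {a : ℝ} (ha : 0 < a) {x : E}
    (h : a • x ∈ C) : x ∈ C := by
  simpa [smul_smul, inv_mul_cancel₀ ha.ne'] using C.smul_mem (inv_pos.2 ha).le h

lemma PointedCone.mem_sup_span_neg {C : PointedCone ℝ E} {w x : E} :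
    x ∈ C ⊔ PointedCone.hull ℝ {-w} ↔ ∃ t : ℝ, 0 ≤ t ∧ x + t • w ∈ C := by
  rw [Submodule.mem_sup]
  constructor
  · rintro ⟨y, hy, z, hz, rfl⟩
    obtain ⟨⟨t, ht⟩, rfl⟩ := Submodule.mem_span_singleton.1 hz
    refine ⟨t, ht, ?_⟩
    simpa [Nonneg.mk_smul] using hy
  · rintro ⟨t, ht, h⟩
    refine ⟨_, h, (⟨t, ht⟩ : {c : ℝ // 0 ≤ c}) • -w,
      Submodule.mem_span_singleton.2 ⟨_, rfl⟩, ?_⟩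
    simp [Nonneg.mk_smul]

/-- Adding to an algebraically closed cone the ray opposite to a vector outside of the cone
gives an algebraically closed cone. -/
lemma AlgClosed.sup_span_neg {C : PointedCone ℝ E} (hC : AlgClosed (C : Set E)) {w : E}
    (hw : w ∉ C) : AlgClosed ((C ⊔ PointedCone.hull ℝ {-w} : PointedCone ℝ E) : Set E) := by
  intro z y h
  simp only [SetLike.mem_coe, PointedCone.mem_sup_span_neg] at h ⊢
  -- The multiples of `w` which are needed near `z` are bounded.
  have hB : ∃ B : ℝ, ∀ α t : ℝ, 0 < α → α ≤ 1 / 2 → 0 ≤ t →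
      (1 - α) • z + α • y + t • w ∈ C → t ≤ B := by
    by_contra! hB
    obtain ⟨t₁, ht₁, h₁⟩ := h 1 one_pos le_rfl
    obtain ⟨t₀, ht₀, h₀⟩ := h (1 / 2) (by norm_num) (by norm_num)
    have h₀' : z + y + (2 * t₀) • w ∈ C := by
      convert C.smul_mem (r := 2) (by norm_num) h₀ using 1
      module
    refine hw (hC w (z + y + (2 * t₀) • w) fun β hβ0 hβ1 => ?_)
    obtain ⟨α, t, hα0, hα1, ht, hmem, hlt⟩ := hB ((1 - β) / β + 2 * t₀)
    have hβ : 0 ≤ (1 - β) / β := div_nonneg (by linarith) hβ0.le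
    have hα : 0 < 1 - α := by linarith
    obtain ⟨T, hT, hTmem⟩ : ∃ T : ℝ, t ≤ T ∧ z + y + T • w ∈ C := by
      refine ⟨(1 - α)⁻¹ * t + (1 - α)⁻¹ * (1 - 2 * α) * t₁, ?_, ?_⟩
      · have h1 : 1 ≤ (1 - α)⁻¹ := (one_le_inv₀ hα).2 (by linarith)
        have h2 : 0 ≤ (1 - α)⁻¹ * (1 - 2 * α) * t₁ :=
          mul_nonneg (mul_nonneg (by linarith) (by linarith)) ht₁
        nlinarith
      · convert C.add_mem (C.smul_mem (inv_pos.2 hα).le hmem)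
          (C.smul_mem (r := (1 - α)⁻¹ * (1 - 2 * α))
            (mul_nonneg (inv_pos.2 hα).le (by linarith)) h₁) using 1
        match_scalars <;> field_simp <;> ring
    have hpos : 0 < T - 2 * t₀ := by linarith
    have hμ : (1 - β) / (T - 2 * t₀) ≤ β := by
      rw [div_le_iff₀ hpos, ← div_le_iff₀' hβ0]
      linarith
    rw [SetLike.mem_coe]
    convert C.add_mem
      (C.smul_mem (r := β - (1 - β) / (T - 2 * t₀)) (by linarith) h₀')
      (C.smul_mem (r := (1 - β) / (T - 2 * t₀))
        (div_nonneg (by linarith) hpos.le) hTmem) using 1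
    match_scalars <;> field_simp <;> ring
  obtain ⟨B, hB⟩ := hB
  let L : ℝ × ℝ × ℝ →ₗ[ℝ] E := (LinearMap.toSpanSingleton ℝ E z).coprod
    ((LinearMap.toSpanSingleton ℝ E y).coprod (LinearMap.toSpanSingleton ℝ E w))
  let Q : Set (ℝ × ℝ) := {p | (1 - p.1) • z + p.1 • y + p.2 • w ∈ C}
  have hQ : IsClosed Q := by
    have hcont : Continuous fun p : ℝ × ℝ => (1 - p.1, p.1, p.2) := by fun_prop
    have := (hC.isClosed_preimage L).preimage hcont
    simpa [L, Q, Set.preimage, add_assoc] using this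
  have hK : IsClosed (Prod.fst '' (Q ∩ Set.Icc 0 (1 / 2) ×ˢ Set.Icc 0 B)) :=
    (((isCompact_Icc.prod isCompact_Icc).inter_left hQ).image continuous_fst).isClosed
  have hsub : Set.Ioo 0 (1 / 2) ⊆ Prod.fst '' (Q ∩ Set.Icc 0 (1 / 2) ×ˢ Set.Icc 0 B) := by
    intro α hα
    obtain ⟨t, ht, hmem⟩ := h α hα.1 (by linarith [hα.2])
    exact ⟨(α, t), ⟨hmem, ⟨hα.1.le, hα.2.le⟩, ht, hB α t hα.1 hα.2.le ht hmem⟩, rfl⟩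
  have h0 := hK.closure_subset_iff.2 hsub
  rw [closure_Ioo (by norm_num)] at h0
  obtain ⟨⟨a, t⟩, ⟨hmem, -, ht⟩, rfl : a = 0⟩ := h0 (Set.left_mem_Icc.2 (by norm_num))
  exact ⟨t, ht.1, by simpa [Q] using hmem⟩

lemma AlgClosed.exists_forall_add_smul_notMem {C : PointedCone ℝ E}
    (hC : AlgClosed (C : Set E)) {v : E} (hv : v ∉ C) (e : E) :
    ∃ ε : ℝ, 0 < ε ∧ ∀ s : ℝ, |s| ≤ ε → v + s • e ∉ C := by
  let L : ℝ × ℝ →ₗ[ℝ] E :=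
    (LinearMap.toSpanSingleton ℝ E v).coprod (LinearMap.toSpanSingleton ℝ E e)
  have hcl : IsClosed {s : ℝ | v + s • e ∈ C} := by
    have := (hC.isClosed_preimage L).preimage (Continuous.prodMk_right (1 : ℝ))
    simpa [L, Set.preimage] using this
  have h0 : (0 : ℝ) ∈ {s : ℝ | v + s • e ∈ C}ᶜ := by simpa using hv
  obtain ⟨ε, hε, hball⟩ := Metric.isOpen_iff.1 hcl.isOpen_compl 0 h0
  refine ⟨ε / 2, by positivity, fun s hs => hball ?_⟩
  rw [Metric.mem_ball, Real.dist_eq, sub_zero]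
  linarith

/-- An algebraically closed cone avoiding `v` can be enlarged so that `-v` becomes internal in the
direction `e`. -/
lemma AlgClosed.exists_le_internal {C : PointedCone ℝ E} (hC : AlgClosed (C : Set E)) {v : E}
    (hv : v ∉ C) (e : E) :
    ∃ D : PointedCone ℝ E, AlgClosed (D : Set E) ∧ v ∉ D ∧ C ≤ D ∧
      ∃ ε : ℝ, 0 < ε ∧ -v + ε • e ∈ D ∧ -v - ε • e ∈ D := by
  obtain ⟨ε, hε, h⟩ := hC.exists_forall_add_smul_notMem hv e
  have key : ∀ a b : ℝ, 0 < a → |b| ≤ a → a • v + (b * ε) • e ∉ C := by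
    intro a b ha hb hmem
    refine h (b / a * ε) ?_ (PointedCone.mem_of_pos_smul_mem ha ?_)
    · rw [abs_mul, abs_div, abs_of_pos ha, abs_of_pos hε]
      exact mul_le_of_le_one_left hε.le ((div_le_one ha).2 hb)
    · convert hmem using 1
      rw [smul_add, smul_smul]
      congr 2
      field_simp
  have hC₁ : AlgClosed ((C ⊔ PointedCone.hull ℝ {-(v + ε • e)} : PointedCone ℝ E) : Set E) := by
    refine hC.sup_span_neg ?_
    have := key 1 1 one_pos (by simp)
    simpa using this
  have hC₂ := hC₁.sup_span_neg (w := v - ε • e) <| by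
    rw [PointedCone.mem_sup_span_neg]
    rintro ⟨t, ht, hmem⟩
    refine key (1 + t) (t - 1) (by linarith) (abs_le.2 ⟨by linarith, by linarith⟩) ?_
    convert hmem using 1
    module
  refine ⟨_, hC₂, ?_, le_sup_left.trans le_sup_left, ε, hε, ?_, ?_⟩
  · rw [PointedCone.mem_sup_span_neg]
    rintro ⟨t, ht, hmem⟩
    obtain ⟨t', ht', hmem⟩ := PointedCone.mem_sup_span_neg.1 hmem
    refine key (1 + t + t') (t' - t) (by linarith) (abs_le.2 ⟨by linarith, by linarith⟩) ?_
    convert hmem using 1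
    module
  · refine le_sup_right (a := C ⊔ PointedCone.hull ℝ {-(v + ε • e)}) (Submodule.subset_span ?_)
    simp [sub_eq_add_neg, add_comm]
  · refine le_sup_left (a := C ⊔ PointedCone.hull ℝ {-(v + ε • e)})
      (le_sup_right (a := C) (Submodule.subset_span ?_))
    simp [sub_eq_add_neg, add_comm]

/-- A cone not containing `v` such that `-v` is internal to the cone is separated from `v`. -/
lemma PointedCone.exists_linearMap_neg_of_internal {s : PointedCone ℝ E} {v : E} (hv : v ∉ s)
    {T : Set E} (hT : Submodule.span ℝ T = ⊤)
    (hint : ∀ e ∈ T, ∃ ε : ℝ, 0 < ε ∧ -v + ε • e ∈ s ∧ -v - ε • e ∈ s) :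
    ∃ g : E →ₗ[ℝ] ℝ, (∀ x ∈ s, 0 ≤ g x) ∧ g v < 0 := by
  have hv0 : v ≠ 0 := fun h => hv (h ▸ s.zero_mem)
  have hdense : ∀ y ∈ Submodule.span ℝ T, ∃ a : ℝ, a • v + y ∈ s ∧ a • v - y ∈ s := by
    intro y hy
    induction hy using Submodule.span_induction with
    | mem e he =>
      obtain ⟨ε, hε, h1, h2⟩ := hint e he
      refine ⟨-ε⁻¹, PointedCone.mem_of_pos_smul_mem hε ?_, PointedCone.mem_of_pos_smul_mem hε ?_⟩
      · convert h1 using 1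
        rw [smul_add, smul_smul, mul_neg, mul_inv_cancel₀ hε.ne', neg_one_smul]
      · convert h2 using 1
        rw [smul_sub, smul_smul, mul_neg, mul_inv_cancel₀ hε.ne', neg_one_smul]
    | zero => exact ⟨0, by simp, by simp⟩
    | add x y _ _ hx hy =>
      obtain ⟨a, ha1, ha2⟩ := hx
      obtain ⟨b, hb1, hb2⟩ := hy
      refine ⟨a + b, ?_, ?_⟩
      · convert s.add_mem ha1 hb1 using 1
        module
      · convert s.add_mem ha2 hb2 using 1
        module
    | smul c x _ hx =>
      obtain ⟨a, ha1, ha2⟩ := hx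
      refine ⟨|c| * a, ?_⟩
      have h1 := s.smul_mem (abs_nonneg c) ha1
      have h2 := s.smul_mem (abs_nonneg c) ha2
      rw [smul_add, smul_smul] at h1
      rw [smul_sub, smul_smul] at h2
      rcases abs_choice c with hc | hc
      · rw [hc] at h1 h2 ⊢
        exact ⟨h1, h2⟩
      · rw [hc] at h1 h2 ⊢
        rw [neg_smul c x] at h1 h2
        exact ⟨by simpa using h2, by simpa [sub_eq_add_neg] using h1⟩
  let f : E →ₗ.[ℝ] ℝ := LinearPMap.mkSpanSingleton v (-1 : ℝ) hv0
  obtain ⟨g, hg1, hg2⟩ := riesz_extension s f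
    (by
      rintro ⟨x, hx⟩ hxs
      obtain ⟨a, rfl⟩ := Submodule.mem_span_singleton.1 hx
      have ha : a ≤ 0 := by
        by_contra! ha
        exact hv (PointedCone.mem_of_pos_smul_mem ha hxs)
      have : f ⟨a • v, hx⟩ = a • (-1 : ℝ) := LinearPMap.mkSpanSingleton'_apply _ _ _ _ _
      rw [this, smul_eq_mul]
      linarith)
    (by
      intro y
      obtain ⟨a, ha, -⟩ := hdense y (hT ▸ Submodule.mem_top)
      exact ⟨⟨a • v, Submodule.mem_span_singleton.2 ⟨a, rfl⟩⟩, ha⟩)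
  refine ⟨g, hg2, ?_⟩
  have h1 := hg1 ⟨v, Submodule.mem_span_singleton_self v⟩
  have h2 : f ⟨v, Submodule.mem_span_singleton_self v⟩ = -1 :=
    LinearPMap.mkSpanSingleton_apply ℝ _ hv0 _
  rw [h2] at h1
  simp only at h1
  linarith

/-- In a space of countable dimension, an algebraically closed cone can be separated from each
vector outside of it. -/
theorem AlgClosed.exists_linearMap_neg (hdim : Module.rank ℝ E ≤ ℵ₀) {C : PointedCone ℝ E}
    (hC : AlgClosed (C : Set E)) {v : E} (hv : v ∉ C) :
    ∃ g : E →ₗ[ℝ] ℝ, (∀ x ∈ C, 0 ≤ g x) ∧ g v < 0 := by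
  obtain ⟨e, he⟩ : ∃ e : ℕ → E, Submodule.span ℝ (Set.range e) = ⊤ := by
    let b := Module.Basis.ofVectorSpace ℝ E
    have hcount : (Set.range b).Countable := by
      rw [← Cardinal.le_aleph0_iff_set_countable, b.mk_range_eq_rank]
      exact hdim
    obtain ⟨e, he⟩ := (hcount.insert 0).exists_eq_range (Set.insert_nonempty _ _)
    refine ⟨e, ?_⟩
    rw [← he, Submodule.span_insert_zero, b.span_eq]
  choose! next hcl hnot hle hint using
    fun (n : ℕ) (D : PointedCone ℝ E) (hD : AlgClosed (D : Set E) ∧ v ∉ D) =>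
      hD.1.exists_le_internal hD.2 (e n)
  obtain ⟨D, hD₀, hDs⟩ : ∃ D : ℕ → PointedCone ℝ E, D 0 = C ∧ ∀ n, D (n + 1) = next n (D n) :=
    ⟨fun n => Nat.rec C next n, rfl, fun _ => rfl⟩
  have hD (n : ℕ) : AlgClosed (D n : Set E) ∧ v ∉ D n := by
    induction n with
    | zero => exact hD₀ ▸ ⟨hC, hv⟩
    | succ n ih => exact hDs n ▸ ⟨hcl n _ ih, hnot n _ ih⟩
  have hmono : Monotone D := monotone_nat_of_le_succ fun n => hDs n ▸ hle n _ (hD n)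
  obtain ⟨g, hg, hgv⟩ := PointedCone.exists_linearMap_neg_of_internal (s := ⨆ n, D n) (v := v)
    (by
      rw [Submodule.mem_iSup_of_directed _ hmono.directed_le]
      rintro ⟨n, hn⟩
      exact (hD n).2 hn)
    he
    (by
      rintro _ ⟨n, rfl⟩
      obtain ⟨ε, hε, h1, h2⟩ := hint n _ (hD n)
      rw [← hDs] at h1 h2
      exact ⟨ε, hε, le_iSup D (n + 1) h1, le_iSup D (n + 1) h2⟩)
  exact ⟨g, fun x hx => hg x (le_iSup D 0 (hD₀.symm ▸ hx)), hgv⟩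

end Cones

section Preorder

variable {M : Set V} {r : V → V → Prop}

lemma sub_mem_posCone_iff (hSI : AxSI M r) {x y : V} (hx : x ∈ M) (hy : y ∈ M) :
    x - y ∈ posCone M r ↔ r x y := by
  refine ⟨?_, fun h => ⟨1, one_pos, x, hx, y, hy, h, by simp⟩⟩
  rintro ⟨l, hl, a, ha, b, hb, hab, hxy⟩
  have hα0 : 0 < 1 / (1 + l) := by positivity
  have hα1 : 1 / (1 + l) < 1 := by rw [div_lt_one (by linarith)]; linarith
  have h := (hSI a ha b hb y hy (1 - 1 / (1 + l)) (by linarith) (by linarith)).1 hab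
  rw [hSI x hx y hy b hb _ hα0 hα1]
  obtain rfl : x = y + l • (a - b) := by rw [← hxy]; abel
  convert h using 1
  · match_scalars <;> field_simp <;> ring
  · module

lemma exists_pointedCone_eq_posCone (hM : M.Nonempty) (hconv : Convex ℝ M)
    (hrefl : ∀ x ∈ M, r x x)
    (htrans : ∀ x ∈ M, ∀ y ∈ M, ∀ z ∈ M, r x y → r y z → r x z) (hSI : AxSI M r) :
    ∃ C : PointedCone ℝ V, (C : Set V) = posCone M r := by
  have hzero : (0 : V) ∈ posCone M r := by
    obtain ⟨x, hx⟩ := hM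
    exact ⟨1, one_pos, x, hx, x, hx, hrefl x hx, by simp⟩
  refine ⟨{ carrier := posCone M r, add_mem' := ?_, zero_mem' := hzero, smul_mem' := ?_ }, rfl⟩
  · rintro _ _ ⟨l, hl, a, ha, b, hb, hab, rfl⟩ ⟨m, hm, c, hc, d, hd, hcd, rfl⟩
    have hα0 : 0 < l / (l + m) := by positivity
    have hα1 : l / (l + m) < 1 := by rw [div_lt_one (by linarith)]; linarith
    have hmix : ∀ p ∈ M, ∀ q ∈ M, (l / (l + m)) • p + (1 - l / (l + m)) • q ∈ M :=
      fun p hp q hq => hconv hp hq hα0.le (by linarith) (by ring)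
    refine ⟨l + m, by linarith, _, hmix a ha c hc, _, hmix b hb d hd, ?_, ?_⟩
    · refine htrans _ (hmix a ha c hc) _ (hmix b hb c hc) _ (hmix b hb d hd)
        ((hSI a ha b hb c hc _ hα0 hα1).1 hab) ?_
      convert (hSI c hc d hd b hb (1 - l / (l + m)) (by linarith) (by linarith)).1 hcd using 1 <;>
        module
    · match_scalars <;> field_simp <;> ring
  · rintro ⟨c, hc⟩ _ ⟨l, hl, a, ha, b, hb, hab, rfl⟩
    rcases hc.eq_or_lt with rfl | hc'
    · simpa [Nonneg.mk_smul] using hzero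
    · exact ⟨c * l, by positivity, a, ha, b, hb, hab, by simp [Nonneg.mk_smul, smul_smul]⟩

lemma algClosed_of_axMC (hconv : Convex ℝ M) (hSI : AxSI M r) (hMC : AxMC M r)
    {C : PointedCone ℝ V} (hC : (C : Set V) = posCone M r) : AlgClosed (C : Set V) := by
  intro v w h
  have hiff : ∀ x ∈ M, ∀ y ∈ M, (x - y ∈ C ↔ r x y) := fun x hx y hy => by
    rw [← sub_mem_posCone_iff hSI hx hy, ← hC, SetLike.mem_coe]
  have hw : w ∈ C := by simpa using h 1 one_pos le_rfl
  have hvw : ∀ t : ℝ, 0 < t → v + t • w ∈ C := by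
    intro t ht
    have ht1 : t / (1 + t) ≤ 1 := by rw [div_le_one (by linarith)]; linarith
    convert C.smul_mem (r := 1 + t) (by linarith)
      (h (t / (1 + t)) (by positivity) ht1) using 1
    match_scalars <;> field_simp
    ring
  by_cases hnw : -w ∈ C
  · convert C.add_mem (hvw 1 one_pos) hnw using 1
    simp
  have hvw1 : v + w ∈ posCone M r := by
    rw [← hC]
    simpa using hvw 1 one_pos
  obtain ⟨m, hm, c, hc, d, hd, -, hcd⟩ := hvw1
  obtain ⟨l, hl, a, ha, b, hb, hab⟩ : ∃ l : ℝ, 0 < l ∧ ∃ a ∈ M, ∃ b ∈ M, v = l • (a - b) := by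
    obtain ⟨k, hk, p, hp, q, hq, -, hpq⟩ : w ∈ posCone M r := hC ▸ hw
    have hα0 : 0 < m / (m + k) := by positivity
    have hα1 : m / (m + k) < 1 := by rw [div_lt_one (by linarith)]; linarith
    refine ⟨m + k, by linarith, _, hconv hc hq hα0.le (sub_nonneg.2 hα1.le) (by ring),
      _, hconv hd hp hα0.le (sub_nonneg.2 hα1.le) (by ring), ?_⟩
    rw [eq_sub_of_add_eq hcd, hpq]
    match_scalars <;> field_simp <;> ring
  set ε : ℝ := 1 / (2 * (l + m)) with hεdef
  have hε : 0 < ε := by positivity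
  have hεl : ε * l ≤ 1 / 2 := by
    rw [hεdef, div_mul_eq_mul_div, div_le_div_iff₀ (by linarith) (by norm_num)]
    linarith
  have hεm : ε * m ≤ 1 / 2 := by
    rw [hεdef, div_mul_eq_mul_div, div_le_div_iff₀ (by linarith) (by norm_num)]
    linarith
  have hmid : ∀ p ∈ M, ∀ q ∈ M, (1 / 2 : ℝ) • p + (1 / 2 : ℝ) • q ∈ M := fun p hp q hq =>
    hconv hp hq (by norm_num) (by norm_num) (by norm_num)
  have hshift : ∀ (p q : V) (k : ℝ), p ∈ M → q ∈ M → 0 ≤ k → k ≤ 1 / 2 →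
      q + (2 * k) • (p - q) ∈ M :=
    fun p q k hp hq hk0 hk1 => by
      convert hconv hp hq (a := 2 * k) (b := 1 - 2 * k) (by linarith) (by linarith) (by ring)
        using 1
      module
  let z : V := (1 / 2 : ℝ) • b + (1 / 2 : ℝ) • d
  have hz : z ∈ M := hmid b hb d hd
  have hy : z + ε • v ∈ M := by
    convert hmid _ (hshift a b (ε * l) ha hb (by positivity) hεl) d hd using 1
    rw [hab]
    simp only [z]
    module
  have hx : z + ε • (v + w) ∈ M := by
    convert hmid b hb _ (hshift c d (ε * m) hc hd (by positivity) hεm) using 1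
    rw [hcd]
    simp only [z]
    module
  have hyz := hMC _ hx _ hy z hz fun α hα0 hα1 => by
    have hmix : α • (z + ε • (v + w)) + (1 - α) • (z + ε • v) ∈ M :=
      hconv hx hy hα0.le (by linarith) (by ring)
    rw [← hiff _ hmix _ hz, ← hiff _ hz _ hmix]
    constructor
    · convert C.smul_mem hε.le (hvw α hα0) using 1
      module
    · intro hneg
      have h1 : -(v + α • w) ∈ C := by
        refine PointedCone.mem_of_pos_smul_mem hε ?_
        convert hneg using 1
        module
      refine hnw (PointedCone.mem_of_pos_smul_mem (half_pos hα0) ?_)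
      convert C.add_mem h1 (hvw (α / 2) (half_pos hα0)) using 1
      module
  rw [← hiff _ hy _ hz, add_sub_cancel_left] at hyz
  exact PointedCone.mem_of_pos_smul_mem hε hyz

end Preorder

theorem stmt_4 (M : Set V) (hM : M.Nonempty) (hconv : Convex ℝ M)
    (r : V → V → Prop) (hrefl : ∀ x ∈ M, r x x)
    (htrans : ∀ x ∈ M, ∀ y ∈ M, ∀ z ∈ M, r x y → r y z → r x z)
    (hSI : AxSI M r) (hMC : AxMC M r)
    (hdim : Module.rank ℝ ↥(diffSpan M) ≤ aleph0) :
    AxMR M r := by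
  obtain ⟨C, hC⟩ := exists_pointedCone_eq_posCone hM hconv hrefl htrans hSI
  have halg : AlgClosed (C : Set V) := algClosed_of_axMC hconv hSI hMC hC
  refine ⟨{u | ∃ g : V →ₗ[ℝ] ℝ, u = g ∧ ∀ x ∈ M, ∀ y ∈ M, r x y → u x ≥ u y},
    ⟨_, 0, rfl, by simp⟩, ?_, fun x hx y hy => ⟨?_, fun h => ?_⟩⟩
  · rintro _ ⟨g, rfl, -⟩ x - y - α - -
    simp
  · rintro h u ⟨-, -, hu⟩
    exact hu x hx y hy h
  · by_contra hxy
    have hmem : ∀ a ∈ M, ∀ b ∈ M, a - b ∈ diffSpan M := fun a ha b hb =>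
      Submodule.subset_span ⟨a, ha, b, hb, rfl⟩
    obtain ⟨g, hg, hneg⟩ := AlgClosed.exists_linearMap_neg hdim
      (C := C.comap (diffSpan M).subtype) (halg.preimage (diffSpan M).subtype)
      (v := ⟨x - y, hmem x hx y hy⟩) (by
        intro hv
        exact hxy ((sub_mem_posCone_iff hSI hx hy).1 (hC ▸ hv)))
    obtain ⟨G, hG⟩ := g.exists_extend
    have hGg : ∀ a (ha : a ∈ diffSpan M), G a = g ⟨a, ha⟩ := fun a ha =>
      LinearMap.congr_fun hG ⟨a, ha⟩
    have hu := h G ⟨G, rfl, fun a ha b hb hab => ?_⟩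
    · rw [← hGg, map_sub] at hneg
      linarith
    · have h1 := hg ⟨a - b, hmem a ha b hb⟩ (by
        change a - b ∈ (C : Set V)
        rw [hC]
        exact (sub_mem_posCone_iff hSI ha hb).2 hab)
      rw [← hGg, map_sub] at h1
      linarith
end

section
/- Let V be a real vector space, M ⊆ V a nonempty convex set, and ≽ a preorder on M satisfying SI. If the dimension (Module.rank over ℝ) of the linear span of {x − y : x, y ∈ M} is at most ℵ₀, then ≽ satisfies CD (countable domination). -/
open Cardinal

variable {V : Type*} [AddCommGroup V] [Module ℝ V]

/-- For a strongly independent preorder, membership of `p - q` in the positive cone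
characterises `r p q`. -/
lemma rel_of_sub_mem_posCone {M : Set V} {r : V → V → Prop} (hSI : AxSI M r) {p q : V}
    (hp : p ∈ M) (hq : q ∈ M) (h : p - q ∈ posCone M r) : r p q := by
  obtain ⟨l, hl, x, hx, y, hy, hxy, e⟩ := h
  have hl1 : (0 : ℝ) < 1 + l := by positivity
  have ha0 : 0 < l / (1 + l) := by positivity
  have ha1 : l / (1 + l) < 1 := by rw [div_lt_one hl1]; linarith
  have h1a : 1 - l / (1 + l) = 1 / (1 + l) := by field_simp; ring
  have h1 := (hSI x hx y hy q hq _ ha0 ha1).1 hxy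
  have hpq : p = l • (x - y) + q := by rw [← e]; abel
  have h2 : (l / (1 + l)) • x + (1 - l / (1 + l)) • q
      = (1 - l / (1 + l)) • p + (1 - (1 - l / (1 + l))) • y := by
    rw [hpq, h1a]
    match_scalars <;> field_simp
    ring
  have h3 : (l / (1 + l)) • y + (1 - l / (1 + l)) • q
      = (1 - l / (1 + l)) • q + (1 - (1 - l / (1 + l))) • y := by
    rw [sub_sub_cancel, add_comm]
  rw [h2, h3] at h1
  exact (hSI p hp q hq y hy _ (by linarith) (by linarith)).2 h1

lemma sub_mem_posCone {M : Set V} {r : V → V → Prop} {x y : V} (hx : x ∈ M) (hy : y ∈ M)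
    (h : r x y) : x - y ∈ posCone M r :=
  ⟨1, one_pos, x, hx, y, hy, h, (one_smul ℝ _).symm⟩

lemma smul_mem_posCone {M : Set V} {r : V → V → Prop} {c : ℝ} (hc : 0 < c) {v : V}
    (h : v ∈ posCone M r) : c • v ∈ posCone M r := by
  obtain ⟨l, hl, x, hx, y, hy, hxy, rfl⟩ := h
  exact ⟨c * l, mul_pos hc hl, x, hx, y, hy, hxy, smul_smul _ _ _⟩

lemma zero_mem_posCone {M : Set V} (hM : M.Nonempty) {r : V → V → Prop}
    (hrefl : ∀ x ∈ M, r x x) : (0 : V) ∈ posCone M r := by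
  obtain ⟨m, hm⟩ := hM
  simpa using sub_mem_posCone hm hm (hrefl m hm)

lemma add_mem_posCone {M : Set V} (hconv : Convex ℝ M) {r : V → V → Prop}
    (htrans : ∀ x ∈ M, ∀ y ∈ M, ∀ z ∈ M, r x y → r y z → r x z) (hSI : AxSI M r) {v w : V}
    (hv : v ∈ posCone M r) (hw : w ∈ posCone M r) : v + w ∈ posCone M r := by
  obtain ⟨k, hk, x, hx, y, hy, hxy, rfl⟩ := hv
  obtain ⟨l, hl, s, hs, t, ht, hst, rfl⟩ := hw
  have hkl : 0 < k + l := by positivity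
  obtain ⟨a, ha⟩ : ∃ a, a = k / (k + l) := ⟨_, rfl⟩
  have ha0 : 0 < a := by rw [ha]; positivity
  have ha1 : a < 1 := by rw [ha, div_lt_one hkl]; linarith
  have hmix {p q : V} (hp : p ∈ M) (hq : q ∈ M) : a • p + (1 - a) • q ∈ M :=
    hconv hp hq ha0.le (by linarith) (by ring)
  have h1 := (hSI x hx y hy s hs a ha0 ha1).1 hxy
  have h2 := (hSI s hs t ht y hy (1 - a) (by linarith) (by linarith)).1 hst
  rw [sub_sub_cancel, add_comm, add_comm ((1 - a) • t)] at h2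
  refine ⟨k + l, hkl, _, hmix hx hs, _, hmix hy ht,
    htrans _ (hmix hx hs) _ (hmix hy hs) _ (hmix hy ht) h1 h2, ?_⟩
  rw [ha]
  match_scalars <;> field_simp <;> ring

lemma sum_smul_mem_posCone {M : Set V} (hM : M.Nonempty) (hconv : Convex ℝ M)
    {r : V → V → Prop} (hrefl : ∀ x ∈ M, r x x)
    (htrans : ∀ x ∈ M, ∀ y ∈ M, ∀ z ∈ M, r x y → r y z → r x z) (hSI : AxSI M r)
    {ι : Type*} (F : Finset ι) (c : ι → ℝ) (v : ι → V) (hc : ∀ i ∈ F, 0 < c i)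
    (hv : ∀ i ∈ F, v i ∈ posCone M r) : ∑ i ∈ F, c i • v i ∈ posCone M r :=
  Finset.sum_induction _ (· ∈ posCone M r)
    (fun _ _ h h' => add_mem_posCone hconv htrans hSI h h') (zero_mem_posCone hM hrefl)
    fun i hi => smul_mem_posCone (hc i hi) (hv i hi)

lemma posCone_subset_diffSpan (M : Set V) (r : V → V → Prop) :
    posCone M r ⊆ diffSpan M := by
  rintro _ ⟨l, -, x, hx, y, hy, -, rfl⟩
  exact (diffSpan M).smul_mem l (Submodule.subset_span ⟨x, hx, y, hy, rfl⟩)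

/-- A set whose span lies in a subspace of countable dimension is spanned by a countable subset
of itself. -/
lemma exists_countable_subset_span_eq {S : Set V} {W : Submodule ℝ V} (hS : S ⊆ W)
    (hW : Module.rank ℝ W ≤ aleph0) :
    ∃ b ⊆ S, b.Countable ∧ Submodule.span ℝ b = Submodule.span ℝ S := by
  obtain ⟨b, hbS, hspan, hli⟩ := exists_linearIndependent ℝ S
  refine ⟨b, hbS, ?_, hspan⟩
  rw [← Cardinal.le_aleph0_iff_set_countable, ← rank_span_set hli]
  exact (Submodule.rank_mono (Submodule.span_le.2 (hbS.trans hS))).trans hW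

theorem stmt_6 (M : Set V) (hM : M.Nonempty) (hconv : Convex ℝ M)
    (r : V → V → Prop) (hrefl : ∀ x ∈ M, r x x)
    (htrans : ∀ x ∈ M, ∀ y ∈ M, ∀ z ∈ M, r x y → r y z → r x z)
    (hSI : AxSI M r)
    (hdim : Module.rank ℝ ↥(diffSpan M) ≤ aleph0) :
    AxCD M r := by
  obtain ⟨b, hbC, hb, hspan⟩ :=
    exists_countable_subset_span_eq (posCone_subset_diffSpan M r) hdim
  have : Countable b := hb.to_subtype
  have hsum (F : Finset b) (c : b → ℝ) (hc : ∀ i ∈ F, 0 < c i) :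
      ∑ i ∈ F, c i • (i : V) ∈ posCone M r :=
    sum_smul_mem_posCone hM hconv hrefl htrans hSI F c _ hc fun i _ => hbC i.2
  choose l hl x hx y hy hxy hv using fun F : Finset b => hsum F 1 fun _ _ => one_pos
  refine ⟨Set.range fun F => (x F, y F), Set.countable_range _, ?_, fun s hs t ht hst => ?_⟩
  · rintro _ ⟨F, rfl⟩
    exact ⟨hx F, hy F, hxy F⟩
  have hw : s - t ∈ Submodule.span ℝ (Set.range ((↑) : b → V)) := by
    rw [Subtype.range_coe, hspan]
    exact Submodule.subset_span (sub_mem_posCone hs ht hst)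
  obtain ⟨c, hc⟩ := Finsupp.mem_span_range_iff_exists_finsupp.1 hw
  set F := c.support
  obtain ⟨k, hk⟩ : ∃ k, k = 1 + ∑ i ∈ F, |c i| := ⟨_, rfl⟩
  have hk0 : 0 < k := by rw [hk]; positivity
  have hck (i : b) (hi : i ∈ F) : 0 < k - c i := by
    have hle : |c i| ≤ ∑ j ∈ F, |c j| :=
      Finset.single_le_sum (f := fun j => |c j|) (fun _ _ => abs_nonneg _) hi
    linarith [le_abs_self (c i)]
  have hdom : (k * l F) • (x F - y F) - (s - t) ∈ posCone M r := by
    have := hsum F (fun i => k - c i) hck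
    rwa [show ∑ i ∈ F, (k - c i) • (i : V) = (k * l F) • (x F - y F) - (s - t) by
      rw [mul_smul, ← hv, ← hc, Finsupp.sum, Finset.smul_sum, ← Finset.sum_sub_distrib]
      simp [sub_smul]] at this
  obtain ⟨m, hm⟩ : ∃ m, m = k * l F := ⟨_, rfl⟩
  have hm0 : 0 < m := by rw [hm]; exact mul_pos hk0 (hl F)
  have hm1 : 0 < 1 + m := by positivity
  have ha0 : 0 < m / (1 + m) := by positivity
  have ha1 : m / (1 + m) < 1 := by rw [div_lt_one hm1]; linarith
  have hmix {p q : V} (hp : p ∈ M) (hq : q ∈ M) :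
      (m / (1 + m)) • p + (1 - m / (1 + m)) • q ∈ M :=
    hconv hp hq ha0.le (by linarith) (by ring)
  refine ⟨_, ⟨F, rfl⟩, m / (1 + m), ha0, ha1,
    rel_of_sub_mem_posCone hSI (hmix (hx F) ht) (hmix (hy F) hs) ?_⟩
  rw [← hm] at hdom
  convert smul_mem_posCone (one_div_pos.2 hm1) hdom using 1
  match_scalars <;> field_simp <;> ring
end
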